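/- Let Ψ be a real T×P matrix with Ψ'Ψ invertible, Ψ̃ a real R×P matrix with Ψ̃Ψ̃' positive definite, Σ̄ a T×T symmetric positive definite matrix, n a positive integer, V := (1/n)·Ψ̃(Ψ'Ψ)⁻¹Ψ'Σ̄Ψ(Ψ'Ψ)⁻¹Ψ̃' and A := V^{-1/2}. Then for every unit vector v ∈ ℝ^R and every d ∈ ℝ^T, |v'AΨ̃(Ψ'Ψ)⁻¹Ψ'd| ≤ (nT)^{1/2}·(max_{1≤t≤T}|d_t|) / λ_min(Σ̄)^{1/2}. -/

import Mathlib

open Matrix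
open scoped BigOperators

/-- Smallest eigenvalue of a symmetric matrix, via the Rayleigh quotient
(Courant–Fischer characterization). -/
noncomputable def eigMin {m : Type*} [Fintype m] (M : Matrix m m ℝ) : ℝ :=
  sInf {r : ℝ | ∃ x : m → ℝ, x ⬝ᵥ x = 1 ∧ r = x ⬝ᵥ M.mulVec x}

/-- The Rayleigh quotient of a real matrix attains its infimum on the unit sphere. -/
lemma eigMin_mem {m : Type*} [Fintype m] [Nonempty m] (M : Matrix m m ℝ) :
    ∃ x : m → ℝ, x ⬝ᵥ x = 1 ∧ eigMin M = x ⬝ᵥ M.mulVec x := by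
  classical
  have hcont : Continuous fun x : m → ℝ => x ⬝ᵥ M.mulVec x := by fun_prop
  have hclosed : IsClosed {x : m → ℝ | x ⬝ᵥ x = 1} :=
    isClosed_eq (by fun_prop) continuous_const
  have hcompact : IsCompact {x : m → ℝ | x ⬝ᵥ x = 1} := by
    refine (isCompact_univ_pi fun _ : m => isCompact_Icc (a := (-1 : ℝ)) (b := 1)).of_isClosed_subset
      hclosed fun x hx i _ => ?_
    have hi : x i * x i ≤ x ⬝ᵥ x :=
      Finset.single_le_sum (f := fun j => x j * x j) (fun j _ => mul_self_nonneg (x j))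
        (Finset.mem_univ i)
    rw [show x ⬝ᵥ x = 1 from hx] at hi
    exact abs_le.mp (abs_le_one_iff_mul_self_le_one.mpr hi)
  obtain ⟨i⟩ := ‹Nonempty m›
  have hne : {x : m → ℝ | x ⬝ᵥ x = 1}.Nonempty := ⟨Pi.single i 1, by simp⟩
  obtain ⟨x, hx, hxM⟩ := (hcompact.image hcont).sInf_mem (hne.image _)
  refine ⟨x, hx, ?_⟩
  have hset : {r : ℝ | ∃ x : m → ℝ, x ⬝ᵥ x = 1 ∧ r = x ⬝ᵥ M.mulVec x} =
      (fun x : m → ℝ => x ⬝ᵥ M.mulVec x) '' {x | x ⬝ᵥ x = 1} := by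
    ext r
    simp [eq_comm]
  rw [eigMin, hset]
  exact hxM.symm

lemma eigMin_pos {m : Type*} [Fintype m] [Nonempty m] {M : Matrix m m ℝ} (hM : M.PosDef) :
    0 < eigMin M := by
  obtain ⟨x, hx, hxM⟩ := eigMin_mem M
  rw [hxM]
  have hx0 : x ≠ 0 := by
    rintro rfl
    simp at hx
  simpa using hM.dotProduct_mulVec_pos hx0

lemma eigMin_mul_dotProduct_le {m : Type*} [Fintype m] {M : Matrix m m ℝ} (hM : M.PosSemidef)
    (w : m → ℝ) : eigMin M * (w ⬝ᵥ w) ≤ w ⬝ᵥ M.mulVec w := by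
  rcases eq_or_ne w 0 with rfl | hw
  · simp
  have hpos : 0 < w ⬝ᵥ w :=
    (Finset.sum_nonneg fun i _ => mul_self_nonneg (w i)).lt_of_ne'
      (mt dotProduct_self_eq_zero.mp hw)
  have hsq : √(w ⬝ᵥ w) * √(w ⬝ᵥ w) = w ⬝ᵥ w := Real.mul_self_sqrt hpos.le
  have hs : √(w ⬝ᵥ w) ≠ 0 := (Real.sqrt_pos.mpr hpos).ne'
  have hle : eigMin M ≤ (w ⬝ᵥ M.mulVec w) / (w ⬝ᵥ w) := by
    refine csInf_le ⟨0, ?_⟩ ⟨(√(w ⬝ᵥ w))⁻¹ • w, ?_, ?_⟩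
    · rintro _ ⟨x, -, rfl⟩
      simpa using hM.dotProduct_mulVec_nonneg x
    · rw [smul_dotProduct, dotProduct_smul, smul_eq_mul, smul_eq_mul, ← mul_assoc, ← mul_inv, hsq,
        inv_mul_cancel₀ hpos.ne']
    · rw [mulVec_smul, smul_dotProduct, dotProduct_smul, smul_eq_mul, smul_eq_mul, ← mul_assoc,
        ← mul_inv, hsq, div_eq_inv_mul]
  exact (le_div_iff₀ hpos).mp hle

lemma dotProduct_self_le_card_mul_iSup_abs_sq {m : Type*} [Fintype m] (d : m → ℝ) :
    d ⬝ᵥ d ≤ Fintype.card m * (⨆ t, |d t|) ^ 2 := by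
  have h : ∀ t ∈ Finset.univ, d t * d t ≤ (⨆ t, |d t|) ^ 2 := fun t _ => by
    rw [← sq, ← sq_abs]
    exact pow_le_pow_left₀ (abs_nonneg _) (le_ciSup (Set.finite_range fun t => |d t|).bddAbove t) 2
  simpa [dotProduct] using Finset.sum_le_card_nsmul _ _ _ h

/-- If `w' M w ≤ c`, then `|w' d| ≤ (c m)^{1/2} max |d| / λ_min(M)^{1/2}`. -/
lemma abs_dotProduct_le_of_quadratic_le {m : Type*} [Fintype m] [Nonempty m] {M : Matrix m m ℝ}
    (hM : M.PosDef) {w : m → ℝ} {c : ℝ} (hw : w ⬝ᵥ M.mulVec w ≤ c) (d : m → ℝ) :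
    |w ⬝ᵥ d| ≤ √(c * Fintype.card m) * (⨆ t, |d t|) / √(eigMin M) := by
  have hl := eigMin_pos hM
  have hc : 0 ≤ c := le_trans (by simpa using hM.posSemidef.dotProduct_mulVec_nonneg w) hw
  have hsup : 0 ≤ ⨆ t, |d t| := Real.iSup_nonneg fun t => abs_nonneg _
  have hww : eigMin M * (w ⬝ᵥ w) ≤ c := (eigMin_mul_dotProduct_le hM.posSemidef w).trans hw
  have hdd : 0 ≤ d ⬝ᵥ d := Finset.sum_nonneg fun i _ => mul_self_nonneg (d i)
  have hcs : (w ⬝ᵥ d) ^ 2 ≤ (w ⬝ᵥ w) * (d ⬝ᵥ d) := by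
    simpa [dotProduct, sq] using Finset.sum_mul_sq_le_sq_mul_sq Finset.univ w d
  rw [le_div_iff₀ (Real.sqrt_pos.mpr hl)]
  refine abs_le_of_sq_le_sq' ?_ (by positivity) |>.2
  rw [mul_pow, mul_pow, sq_abs, Real.sq_sqrt hl.le, Real.sq_sqrt (by positivity)]
  calc (w ⬝ᵥ d) ^ 2 * eigMin M ≤ (w ⬝ᵥ w) * (d ⬝ᵥ d) * eigMin M := by gcongr
    _ = eigMin M * (w ⬝ᵥ w) * (d ⬝ᵥ d) := by ring
    _ ≤ c * (Fintype.card m * (⨆ t, |d t|) ^ 2) :=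
      mul_le_mul hww (dotProduct_self_le_card_mul_iSup_abs_sq d) hdd hc
    _ = c * Fintype.card m * (⨆ t, |d t|) ^ 2 := by ring

theorem bias_term_bound
    (T P R n : ℕ) (hT : 0 < T) (hP : 0 < P) (hR : 0 < R) (hn : 0 < n)
    (Ψ : Matrix (Fin T) (Fin P) ℝ) (hΨ : IsUnit (Ψᵀ * Ψ).det)
    (Ψt : Matrix (Fin R) (Fin P) ℝ) (hΨt : (Ψt * Ψtᵀ).PosDef)
    (Sb : Matrix (Fin T) (Fin T) ℝ) (hSb : Sb.PosDef)
    (V : Matrix (Fin R) (Fin R) ℝ)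
    (hV : V = (n : ℝ)⁻¹ • (Ψt * (Ψᵀ * Ψ)⁻¹ * Ψᵀ * Sb * Ψ * (Ψᵀ * Ψ)⁻¹ * Ψtᵀ))
    (hVpd : V.PosDef)
    -- `A = V^{-1/2}`: the symmetric positive definite square root of `V⁻¹`
    (A : Matrix (Fin R) (Fin R) ℝ) (hA : A.PosDef) (hAV : V * (A * A) = 1) :
    ∀ v : Fin R → ℝ, v ⬝ᵥ v = 1 → ∀ d : Fin T → ℝ,
      |v ⬝ᵥ (A * Ψt * (Ψᵀ * Ψ)⁻¹ * Ψᵀ).mulVec d| ≤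
        Real.sqrt ((n : ℝ) * (T : ℝ)) * (⨆ t, |d t|) / Real.sqrt (eigMin Sb) := by
  intro v hv d
  have : Nonempty (Fin T) := ⟨⟨0, hT⟩⟩
  have hn' : (n : ℝ) ≠ 0 := by positivity
  set B := Ψt * (Ψᵀ * Ψ)⁻¹ * Ψᵀ with hB
  have hBt : Bᵀ = Ψ * (Ψᵀ * Ψ)⁻¹ * Ψtᵀ := by
    simp [hB, transpose_mul, transpose_nonsing_inv, Matrix.mul_assoc]
  have hVB : B * Sb * Bᵀ = (n : ℝ) • V := by
    rw [hV, smul_smul, mul_inv_cancel₀ hn', one_smul, hBt]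
    simp only [Matrix.mul_assoc]
  have hAVA : A * V * A = 1 := by
    have h : A * (V * A) = 1 := mul_eq_one_comm.mp (by rw [Matrix.mul_assoc, hAV])
    rwa [Matrix.mul_assoc]
  have hAt : Aᵀ = A := by simpa using hA.isHermitian.eq
  have hABt : (A * B)ᵀ = Bᵀ * A := by rw [transpose_mul, hAt]
  have hquad : (A * B) * Sb * (A * B)ᵀ = (n : ℝ) • 1 := by
    calc (A * B) * Sb * (A * B)ᵀ = A * (B * Sb * Bᵀ) * A := by
          rw [hABt]
          simp only [Matrix.mul_assoc]
      _ = (n : ℝ) • 1 := by rw [hVB, Matrix.mul_smul, Matrix.smul_mul, hAVA]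
  have hw : (v ᵥ* (A * B)) ⬝ᵥ Sb.mulVec (v ᵥ* (A * B)) ≤ (n : ℝ) := by
    rw [← dotProduct_mulVec, ← mulVec_transpose,
      mulVec_mulVec, mulVec_mulVec, hquad, smul_mulVec, one_mulVec,
      dotProduct_smul, hv, smul_eq_mul, mul_one]
  have hAB : A * Ψt * (Ψᵀ * Ψ)⁻¹ * Ψᵀ = A * B := by
    simp only [hB, Matrix.mul_assoc]
  rw [hAB, dotProduct_mulVec]
  simpa using abs_dotProduct_le_of_quadratic_le hSb hw d
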